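/- arXiv:2202.11212 — 2 statements merged into one kernel-verified Lean document; each statement's English description precedes it below -/
import Mathlib

section
/- Let Ψ: ℕ → [1,∞), let m ≥ 1, let t_0,…,t_{m-1} > 0, set t_max = max_i t_i and ℓ = #{i : t_i = t_max}. If the series Σ_n (log Ψ(n))^{ℓ−1} / Ψ(n)^{1/t_max} diverges, then the set of x ∈ [0,1) such that a_n(x)^{t_0} ··· a_{n+m-1}(x)^{t_{m-1}} ≥ Ψ(n) for infinitely many n has full Lebesgue measure in [0,1). -/
open scoped BigOperators

noncomputable def gaussMap (x : ℝ) : ℝ := Int.fract (1 / x)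

noncomputable def partQuot (x : ℝ) (n : ℕ) : ℕ := ⌊1 / (gaussMap^[n - 1] x)⌋₊

open MeasureTheory Set Filter
open scoped ENNReal

/-- The product `∏ a_{i+1}(x) ^ t i` of powers of the first `m` partial quotients of `x`. -/
noncomputable def digitProd (m : ℕ) (t : Fin m → ℝ) (x : ℝ) : ℝ :=
  ∏ i : Fin m, ((⌊1 / gaussMap^[(i : ℕ)] x⌋₊ : ℕ) : ℝ) ^ t i

/-- The mass of `A` for the probability measure on `[0, 1)` with density
`(1 + θ) / (1 + θ x) ^ 2`. -/
noncomputable def mobiusMass (θ : ℝ) (A : Set ℝ) : ℝ≥0∞ :=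
  ∫⁻ x in Ico (0 : ℝ) 1, A.indicator 1 x * ENNReal.ofReal ((1 + θ) / (1 + θ * x) ^ 2)

/-- A lower bound for the probability that the first partial quotient equals `b + 1`. -/
noncomputable def digitWeight (b : ℕ) : ℝ≥0∞ := ENNReal.ofReal (1 / ((b + 2) * (b + 3)))

/-- A lower bound for the probability of `ψ ≤ digitProd m t x`, obtained by giving independent
weights `digitWeight` to the digits. -/
noncomputable def tailWeight : (m : ℕ) → (Fin m → ℝ) → ℝ → ℝ≥0∞
  | 0, _, ψ => if ψ ≤ 1 then 1 else 0
  | m + 1, t, ψ =>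
    ∑' b : ℕ, digitWeight b * tailWeight m (Fin.tail t) (ψ / ((b : ℝ) + 1) ^ t 0)

lemma floor_inv_branch (b : ℕ) {y : ℝ} (hy : y ∈ Ico (0 : ℝ) 1) :
    ⌊1 / (1 / ((b : ℝ) + 1 + y))⌋₊ = b + 1 := by
  rw [one_div_one_div, Nat.floor_eq_iff (by have := hy.1; positivity)]
  push_cast
  exact ⟨by linarith [hy.1], by linarith [hy.2]⟩

lemma gaussMap_branch (b : ℕ) {y : ℝ} (hy : y ∈ Ico (0 : ℝ) 1) :
    gaussMap (1 / ((b : ℝ) + 1 + y)) = y := by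
  unfold gaussMap
  rw [one_div_one_div, Int.fract_eq_iff]
  exact ⟨hy.1, hy.2, (b : ℤ) + 1, by push_cast; ring⟩

lemma digitProd_succ (m : ℕ) (t : Fin (m + 1) → ℝ) (x : ℝ) :
    digitProd (m + 1) t x
      = ((⌊1 / x⌋₊ : ℕ) : ℝ) ^ t 0 * digitProd m (Fin.tail t) (gaussMap x) := by
  simp [digitProd, Fin.prod_univ_succ, Fin.tail]

lemma mobiusMass_mono (θ : ℝ) {A B : Set ℝ} (h : ∀ x ∈ Ico (0 : ℝ) 1, x ∈ A → x ∈ B) :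
    mobiusMass θ A ≤ mobiusMass θ B := by
  refine setLIntegral_mono' measurableSet_Ico fun x hx => ?_
  refine mul_le_mul_left (indicator_apply_le' (fun hA => ?_) fun _ => zero_le) _
  simp [indicator_of_mem (h x hx hA)]

lemma mobiusMass_le_two {θ : ℝ} (hθ : θ ∈ Icc (0 : ℝ) 1) (A : Set ℝ) : mobiusMass θ A ≤ 2 := by
  calc mobiusMass θ A ≤ ∫⁻ x in Ico (0 : ℝ) 1, 2 := by
        refine setLIntegral_mono' measurableSet_Ico fun x hx => ?_
        have h1 : A.indicator (1 : ℝ → ℝ≥0∞) x ≤ 1 := indicator_le_self' (by simp) x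
        have h2 : ENNReal.ofReal ((1 + θ) / (1 + θ * x) ^ 2) ≤ 2 := by
          rw [show (2 : ℝ≥0∞) = ENNReal.ofReal 2 by simp]
          apply ENNReal.ofReal_le_ofReal
          have : 0 ≤ θ * x := mul_nonneg hθ.1 hx.1
          rw [div_le_iff₀ (by positivity)]
          nlinarith [hθ.2]
        simpa using mul_le_mul' h1 h2
    _ = 2 := by simp

lemma iUnion_Ioc_one_div :
    ⋃ b : ℕ, Ioc (1 / ((b : ℝ) + 2)) (1 / ((b : ℝ) + 1)) = Ioc (0 : ℝ) 1 := by
  ext x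
  simp only [mem_iUnion, mem_Ioc]
  constructor
  · rintro ⟨b, h1, h2⟩
    refine ⟨lt_trans (by positivity) h1, h2.trans ?_⟩
    rw [div_le_one (by positivity)]
    linarith [(Nat.cast_nonneg b : (0 : ℝ) ≤ b)]
  · rintro ⟨h0, h1⟩
    have hx : 1 ≤ 1 / x := by rwa [le_div_iff₀ h0, one_mul]
    obtain ⟨b, hb⟩ : ∃ b, ⌊1 / x⌋₊ = b + 1 :=
      Nat.exists_eq_succ_of_ne_zero (Nat.floor_pos.2 hx).ne'
    have h := (Nat.floor_eq_iff (by positivity)).1 hb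
    push_cast at h
    refine ⟨b, ?_, ?_⟩
    · rw [div_lt_comm₀ (by positivity) h0]; linarith [h.2]
    · rw [le_div_comm₀ h0 (by positivity)]; exact h.1

lemma pairwise_disjoint_Ioc_one_div :
    Pairwise (Function.onFun Disjoint
      fun b : ℕ => Ioc (1 / ((b : ℝ) + 2)) (1 / ((b : ℝ) + 1))) := by
  rw [pairwise_disjoint_on]
  intro i j hij
  rw [Set.disjoint_left]
  rintro x ⟨h1, _⟩ ⟨_, h2⟩
  have : (i : ℝ) + 1 ≤ j := by exact_mod_cast hij
  have h3 : 1 / ((j : ℝ) + 1) ≤ 1 / ((i : ℝ) + 2) :=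
    one_div_le_one_div_of_le (by positivity) (by linarith)
  linarith

lemma image_branch (b : ℕ) :
    (fun y : ℝ => 1 / ((b : ℝ) + 1 + y)) '' Ico (0 : ℝ) 1
      = Ioc (1 / ((b : ℝ) + 2)) (1 / ((b : ℝ) + 1)) := by
  ext x
  simp only [mem_image, mem_Ico, mem_Ioc]
  constructor
  · rintro ⟨y, ⟨h0, h1⟩, rfl⟩
    exact ⟨one_div_lt_one_div_of_lt (by positivity) (by linarith),
      one_div_le_one_div_of_le (by positivity) (by linarith)⟩
  · rintro ⟨h1, h2⟩
    have hx : 0 < x := lt_trans (by positivity) h1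
    refine ⟨1 / x - (b + 1), ⟨?_, ?_⟩, ?_⟩
    · rw [le_div_comm₀ hx (by positivity)] at h2; linarith
    · rw [div_lt_comm₀ (by positivity) hx] at h1; linarith
    · rw [add_sub_cancel, one_div_one_div]

lemma mobiusMass_eq_tsum {θ : ℝ} (hθ : θ ∈ Icc (0 : ℝ) 1) (A : Set ℝ) :
    mobiusMass θ A = ∑' b : ℕ, ENNReal.ofReal ((1 + θ) / ((b + 1 + θ) * (b + 2 + θ))) *
      mobiusMass (1 / (b + 1 + θ)) {y | 1 / ((b : ℝ) + 1 + y) ∈ A} := by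
  have hθ0 := hθ.1
  rw [mobiusMass, setLIntegral_congr Ico_ae_eq_Ioc, ← iUnion_Ioc_one_div,
    lintegral_iUnion (fun _ => measurableSet_Ioc) pairwise_disjoint_Ioc_one_div]
  refine tsum_congr fun b => ?_
  rw [← image_branch, lintegral_image_eq_lintegral_abs_deriv_mul measurableSet_Ico
    (f' := fun y => -1 / ((b : ℝ) + 1 + y) ^ 2), mobiusMass,
    ← lintegral_const_mul' _ _ ENNReal.ofReal_ne_top]
  · refine setLIntegral_congr_fun measurableSet_Ico fun y hy => ?_
    have hy0 := hy.1
    have hi : A.indicator (1 : ℝ → ℝ≥0∞) (1 / ((b : ℝ) + 1 + y))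
        = {y | 1 / ((b : ℝ) + 1 + y) ∈ A}.indicator 1 y := by
      simp [indicator]
    simp only [hi]
    rw [mul_left_comm, mul_left_comm (ENNReal.ofReal ((1 + θ) / _)),
      ← ENNReal.ofReal_mul (abs_nonneg _), ← ENNReal.ofReal_mul (by positivity)]
    congr 2
    rw [abs_div, abs_neg, abs_one, abs_of_pos (by positivity)]
    have h1 : (1 + θ * (1 / ((b : ℝ) + 1 + y))) = (b + 1 + y + θ) / (b + 1 + y) := by
      field_simp
    have h2 : (1 + 1 / ((b : ℝ) + 1 + θ) * y) = (b + 1 + y + θ) / (b + 1 + θ) := by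
      field_simp; ring
    have h3 : (1 + 1 / ((b : ℝ) + 1 + θ)) = (b + 2 + θ) / (b + 1 + θ) := by
      field_simp; ring
    rw [h1, h2, h3]
    field_simp
  · intro y hy
    have hy0 := hy.1
    have hne : (b : ℝ) + 1 + y ≠ 0 := by positivity
    have := ((hasDerivAt_id' y).const_add ((b : ℝ) + 1)).fun_inv hne
    simpa only [one_div] using this.hasDerivWithinAt
  · intro y hy z hz h
    simpa using h

lemma tsum_branch_le_one {θ : ℝ} (hθ : 0 ≤ θ) :
    ∑' b : ℕ, ENNReal.ofReal ((1 + θ) / ((b + 1 + θ) * (b + 2 + θ))) ≤ 1 := by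
  refine ENNReal.tsum_le_of_sum_range_le fun n => ?_
  rw [← ENNReal.ofReal_sum_of_nonneg (fun b _ => by positivity)]
  have : ∀ n : ℕ, ∑ b ∈ Finset.range n, (1 + θ) / (((b : ℝ) + 1 + θ) * (b + 2 + θ))
      = 1 - (1 + θ) / (n + 1 + θ) := by
    intro n
    induction n with
    | zero => simp; field_simp; ring
    | succ k ih =>
      rw [Finset.sum_range_succ, ih]
      push_cast
      have h1 : (k : ℝ) + 1 + θ ≠ 0 := by positivity
      have h2 : (k : ℝ) + 2 + θ ≠ 0 := by positivity
      have h3 : (k : ℝ) + 1 + 1 + θ ≠ 0 := by positivity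
      field_simp
      ring
  rw [this]
  have h : 0 ≤ (1 + θ) / ((n : ℝ) + 1 + θ) := by positivity
  simpa using h

lemma one_div_branch_mem {θ : ℝ} (hθ : θ ∈ Icc (0 : ℝ) 1) (b : ℕ) :
    1 / ((b : ℝ) + 1 + θ) ∈ Icc (0 : ℝ) 1 := by
  have h := hθ.1
  refine ⟨by positivity, ?_⟩
  rw [div_le_one (by positivity)]
  linarith [(Nat.cast_nonneg b : (0 : ℝ) ≤ b)]

lemma digitWeight_le {θ : ℝ} (hθ : θ ∈ Icc (0 : ℝ) 1) (b : ℕ) :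
    digitWeight b ≤ ENNReal.ofReal ((1 + θ) / ((b + 1 + θ) * (b + 2 + θ))) := by
  obtain ⟨h0, h1⟩ := hθ
  apply ENNReal.ofReal_le_ofReal
  rw [div_le_div_iff₀ (by positivity) (by positivity)]
  nlinarith [(Nat.cast_nonneg b : (0 : ℝ) ≤ b), mul_nonneg (Nat.cast_nonneg b : (0 : ℝ) ≤ b) h0]

/-- Prescribing `digitProd m t x < ψ` before asking that the `m`-th iterate lie in `A` costs a
proportion of at least `tailWeight m t ψ`. -/
lemma mobiusMass_add_tailWeight_le (m : ℕ) (t : Fin m → ℝ) (ψ : ℝ) {A : Set ℝ} {u : ℝ≥0∞}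
    (hA : ∀ θ ∈ Icc (0 : ℝ) 1, mobiusMass θ A ≤ u) {θ : ℝ} (hθ : θ ∈ Icc (0 : ℝ) 1) :
    mobiusMass θ {x | digitProd m t x < ψ ∧ gaussMap^[m] x ∈ A} + tailWeight m t ψ * u ≤ u := by
  induction m generalizing ψ θ with
  | zero =>
    by_cases h : ψ ≤ 1
    · simp [tailWeight, h, digitProd, h.not_gt, mobiusMass]
    · simpa [tailWeight, h, digitProd, not_le.1 h] using hA θ hθ
  | succ m ih =>
    rw [mobiusMass_eq_tsum hθ, tailWeight, ← ENNReal.tsum_mul_right, ← ENNReal.tsum_add]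
    calc _ ≤ ∑' b : ℕ, ENNReal.ofReal ((1 + θ) / ((b + 1 + θ) * (b + 2 + θ))) * u := by
          refine ENNReal.tsum_le_tsum fun b => ?_
          refine le_trans ?_ (mul_le_mul_right
            (ih (Fin.tail t) (ψ / ((b : ℝ) + 1) ^ t 0) (one_div_branch_mem hθ b)) _)
          rw [mul_add (ENNReal.ofReal _), mul_assoc (digitWeight b)]
          refine add_le_add (mul_le_mul_right (mobiusMass_mono _ fun y hy h => ?_) _)
            (mul_le_mul_left (digitWeight_le hθ b) _)
          simp only [mem_ofPred_eq, digitProd_succ, floor_inv_branch b hy, gaussMap_branch b hy,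
            Function.iterate_succ_apply] at h
          push_cast at h
          refine ⟨?_, h.2⟩
          rw [lt_div_iff₀ (by positivity), mul_comm]
          exact h.1
      _ ≤ u := by
          rw [ENNReal.tsum_mul_right]
          simpa using mul_le_mul_left (tsum_branch_le_one hθ.1) u

lemma mobiusMass_mul_prod_le (m : ℕ) (t : Fin m → ℝ) (K : ℕ) (ψ : ℕ → ℝ) {θ : ℝ}
    (hθ : θ ∈ Icc (0 : ℝ) 1) :
    mobiusMass θ {x | ∀ j < K, digitProd m t (gaussMap^[m * j] x) < ψ j} *
      ∏ j ∈ Finset.range K, (1 + tailWeight m t (ψ j)) ≤ 2 := by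
  induction K generalizing ψ θ with
  | zero => simpa using mobiusMass_le_two hθ _
  | succ K ih =>
    set A := {x | ∀ j < K, digitProd m t (gaussMap^[m * j] x) < ψ (j + 1)}
    set R := ∏ j ∈ Finset.range K, (1 + tailWeight m t (ψ (j + 1)))
    set B := {x | digitProd m t x < ψ 0 ∧ gaussMap^[m] x ∈ A}
    have hR0 : R ≠ 0 := by
      refine Finset.prod_ne_zero_iff.2 fun j _ => ?_
      simp
    have hA : ∀ θ ∈ Icc (0 : ℝ) 1, mobiusMass θ A ≤ 2 / R := fun θ hθ => by
      rw [ENNReal.le_div_iff_mul_le (Or.inl hR0) (Or.inr (by simp))]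
      exact ih (fun j => ψ (j + 1)) hθ
    have hB := mobiusMass_add_tailWeight_le m t (ψ 0) hA hθ
    have hsub : mobiusMass θ {x | ∀ j < K + 1, digitProd m t (gaussMap^[m * j] x) < ψ j}
        ≤ mobiusMass θ B := by
      refine mobiusMass_mono _ fun x _ h => ⟨by simpa using h 0 (by omega), fun j hj => ?_⟩
      rw [← Function.iterate_add_apply, ← Nat.mul_succ]
      exact h (j + 1) (by omega)
    rw [Finset.prod_range_succ']
    have hB' : mobiusMass θ B * (1 + tailWeight m t (ψ 0)) ≤ 2 / R := by
      refine le_trans ?_ hB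
      rw [mul_add, mul_one, mul_comm (mobiusMass θ B)]
      gcongr
      exact le_self_add.trans hB
    calc _ ≤ mobiusMass θ B * (R * (1 + tailWeight m t (ψ 0))) := by gcongr
      _ = mobiusMass θ B * (1 + tailWeight m t (ψ 0)) * R := by ring
      _ ≤ 2 / R * R := by gcongr
      _ ≤ 2 := ENNReal.mul_le_of_le_div le_rfl

lemma sum_le_prod_one_add (f : ℕ → ℝ≥0∞) (K : ℕ) :
    ∑ j ∈ Finset.range K, f j ≤ ∏ j ∈ Finset.range K, (1 + f j) := by
  suffices h : 1 + ∑ j ∈ Finset.range K, f j ≤ ∏ j ∈ Finset.range K, (1 + f j) from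
    le_add_self.trans h
  induction K with
  | zero => simp
  | succ K ih =>
    rw [Finset.sum_range_succ, Finset.prod_range_succ, mul_add, mul_one, ← add_assoc]
    gcongr
    exact le_mul_of_one_le_left' (le_self_add.trans ih)

lemma mobiusMass_forall_eq_zero (m : ℕ) (t : Fin m → ℝ) (ψ : ℕ → ℝ)
    (hψ : ∑' j, tailWeight m t (ψ j) = ∞) {θ : ℝ} (hθ : θ ∈ Icc (0 : ℝ) 1) :
    mobiusMass θ {x | ∀ j, digitProd m t (gaussMap^[m * j] x) < ψ j} = 0 := by
  set M := mobiusMass θ {x | ∀ j, digitProd m t (gaussMap^[m * j] x) < ψ j}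
  have h : ∀ K, ∑ j ∈ Finset.range K, M * tailWeight m t (ψ j) ≤ 2 := fun K => by
    rw [← Finset.mul_sum]
    refine le_trans ?_ (mobiusMass_mul_prod_le m t K ψ hθ)
    exact mul_le_mul' (mobiusMass_mono _ fun x _ h j _ => h j) (sum_le_prod_one_add _ K)
  have h2 := ENNReal.tsum_le_of_sum_range_le h
  rw [ENNReal.tsum_mul_left, hψ] at h2
  by_contra hM
  rw [ENNReal.mul_top hM] at h2
  simp at h2

lemma mobiusMass_preimage_iterate_eq_zero {A : Set ℝ}
    (hA : ∀ θ ∈ Icc (0 : ℝ) 1, mobiusMass θ A = 0) (k : ℕ) {θ : ℝ} (hθ : θ ∈ Icc (0 : ℝ) 1) :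
    mobiusMass θ (gaussMap^[k] ⁻¹' A) = 0 := by
  induction k generalizing θ with
  | zero => simpa using hA θ hθ
  | succ k ih =>
    rw [mobiusMass_eq_tsum hθ, ENNReal.tsum_eq_zero]
    intro b
    refine mul_eq_zero_of_right _ (le_antisymm ?_ bot_le)
    rw [← ih (one_div_branch_mem hθ b)]
    refine mobiusMass_mono _ fun y hy h => ?_
    simpa only [mem_ofPred_eq, mem_preimage, Function.iterate_succ_apply,
      gaussMap_branch b hy] using h

lemma measurable_gaussMap : Measurable gaussMap := by
  unfold gaussMap
  fun_prop

lemma measurable_digitProd (m : ℕ) (t : Fin m → ℝ) : Measurable (digitProd m t) := by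
  unfold digitProd
  refine Finset.measurable_prod _ fun i _ => ?_
  have h : Measurable fun x => ⌊1 / gaussMap^[(i : ℕ)] x⌋₊ :=
    Nat.measurable_floor.comp ((measurable_gaussMap.iterate i).const_div 1)
  exact (measurable_from_top.comp h).pow_const _

lemma volume_inter_eq_zero {A : Set ℝ} (hA : MeasurableSet A) (h : mobiusMass 0 A = 0) :
    volume (A ∩ Ico (0 : ℝ) 1) = 0 := by
  simpa [mobiusMass, lintegral_indicator_one hA, Measure.restrict_apply hA] using h

lemma digitWeight_zero : digitWeight 0 = ENNReal.ofReal (1 / 6) := by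
  unfold digitWeight
  norm_num

lemma mul_tailWeight_le_succ (m : ℕ) (t : Fin (m + 1) → ℝ) (ψ : ℝ) :
    ENNReal.ofReal (1 / 6) * tailWeight m (Fin.tail t) ψ ≤ tailWeight (m + 1) t ψ := by
  rw [tailWeight, ← digitWeight_zero]
  refine le_trans ?_ (ENNReal.le_tsum 0)
  simp

lemma card_filter_tail (m : ℕ) (t : Fin (m + 1) → ℝ) (s : ℝ) :
    (Finset.univ.filter fun i => t i = s).card
      = (if t 0 = s then 1 else 0) + (Finset.univ.filter fun i => Fin.tail t i = s).card := by
  rw [Finset.card_filter, Finset.card_filter, Fin.sum_univ_succ]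
  rfl

lemma tailWeight_succ_ge_of_const {m : ℕ} {t : Fin (m + 1) → ℝ} {s c ψ : ℝ} (hs : 0 < s)
    (hc : 0 < c) (ht : t 0 = s)
    (h : ∀ ψ ≤ 1, ENNReal.ofReal c ≤ tailWeight m (Fin.tail t) ψ) (hψ : 1 ≤ ψ) :
    ENNReal.ofReal (c / 24 / ψ ^ (1 / s)) ≤ tailWeight (m + 1) t ψ := by
  set N := ψ ^ (1 / s) with hN
  have hN1 : 1 ≤ N := Real.one_le_rpow hψ (by positivity)
  have hNs : N ^ s = ψ := by
    rw [hN, ← Real.rpow_mul (by linarith), one_div_mul_cancel hs.ne', Real.rpow_one]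
  set n := ⌈N⌉₊
  have hn : N ≤ n := Nat.le_ceil N
  have hn2 : (n : ℝ) ≤ 2 * N := by linarith [Nat.ceil_lt_add_one (by linarith : 0 ≤ N)]
  have hn1 : (1 : ℝ) ≤ n := hN1.trans hn
  rw [tailWeight, ht]
  refine le_trans ?_ (ENNReal.sum_le_tsum (Finset.Ico n (2 * n)))
  calc ENNReal.ofReal (c / 24 / N)
      ≤ ∑ b ∈ Finset.Ico n (2 * n), ENNReal.ofReal (1 / (12 * (n : ℝ) ^ 2) * c) := by
        rw [Finset.sum_const, nsmul_eq_mul, Nat.card_Ico, ← ENNReal.ofReal_natCast,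
          ← ENNReal.ofReal_mul (by positivity)]
        apply ENNReal.ofReal_le_ofReal
        have : ((2 * n - n : ℕ) : ℝ) = n := by congr 1; omega
        rw [this]
        have h2 : (n : ℝ) * (1 / (12 * (n : ℝ) ^ 2) * c) = c / (12 * n) := by field_simp
        rw [h2, div_div]
        gcongr c / ?_
        linarith
    _ ≤ _ := by
        refine Finset.sum_le_sum fun b hb => ?_
        rw [Finset.mem_Ico] at hb
        have hb1 : (n : ℝ) ≤ b := by exact_mod_cast hb.1
        have hb2 : (b : ℝ) + 1 ≤ 2 * n := by exact_mod_cast hb.2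
        rw [ENNReal.ofReal_mul (by positivity)]
        refine mul_le_mul' (ENNReal.ofReal_le_ofReal ?_) (h _ ?_)
        · gcongr 1 / ?_
          nlinarith
        · rw [div_le_one (by positivity), ← hNs]
          gcongr
          linarith

lemma tailWeight_succ_ge_of_log {m k : ℕ} {t : Fin (m + 1) → ℝ} {s c ψ : ℝ} (hs : 0 < s)
    (hc : 0 < c) (ht : t 0 = s)
    (h : ∀ ψ, 1 ≤ ψ →
      ENNReal.ofReal (c * (Real.log ψ ^ k / ψ ^ (1 / s))) ≤ tailWeight m (Fin.tail t) ψ)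
    (hψ : 1 ≤ ψ) :
    ENNReal.ofReal (c / (12 * s * 2 ^ k) * (Real.log ψ ^ (k + 1) / ψ ^ (1 / s)))
      ≤ tailWeight (m + 1) t ψ := by
  set N := ψ ^ (1 / s) with hN
  have hψ0 : 0 < ψ := by linarith
  have hN1 : 1 ≤ N := Real.one_le_rpow hψ (by positivity)
  have hN0 : 0 < N := by linarith
  have hNs : N ^ s = ψ := by
    rw [hN, ← Real.rpow_mul (by linarith), one_div_mul_cancel hs.ne', Real.rpow_one]
  have hL : Real.log ψ = s * Real.log N := by rw [← hNs, Real.log_rpow hN0]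
  have hLN : 0 ≤ Real.log N := Real.log_nonneg hN1
  have hL0 : 0 ≤ Real.log ψ := Real.log_nonneg hψ
  set n := ⌊√N⌋₊
  have hharm : Real.log N / 2 ≤ ∑ b ∈ Finset.range n, 1 / ((b : ℝ) + 1) := by
    have h1 := log_add_one_le_harmonic n
    rw [harmonic] at h1
    push_cast at h1
    have h2 : Real.log N / 2 ≤ Real.log (n + 1) := by
      rw [← Real.log_sqrt hN0.le]
      exact Real.log_le_log (Real.sqrt_pos.2 hN0) (Nat.lt_floor_add_one _).le
    simpa [one_div] using h2.trans h1
  rw [tailWeight, ht]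
  refine le_trans ?_ (ENNReal.sum_le_tsum (Finset.range n))
  calc ENNReal.ofReal (c / (12 * s * 2 ^ k) * (Real.log ψ ^ (k + 1) / N))
      ≤ ENNReal.ofReal (∑ b ∈ Finset.range n,
          c * (Real.log ψ / 2) ^ k / (6 * N) * (1 / ((b : ℝ) + 1))) := by
        apply ENNReal.ofReal_le_ofReal
        rw [← Finset.mul_sum]
        refine le_trans (le_of_eq ?_) (mul_le_mul_of_nonneg_left hharm (by positivity))
        rw [hL, div_pow]
        field_simp
        ring
    _ = ∑ b ∈ Finset.range n, ENNReal.ofReal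
          (c * (Real.log ψ / 2) ^ k / (6 * N) * (1 / ((b : ℝ) + 1))) :=
        ENNReal.ofReal_sum_of_nonneg fun b _ => by positivity
    _ ≤ _ := by
        refine Finset.sum_le_sum fun b hb => ?_
        have hb1 : (b : ℝ) + 1 ≤ √N := by
          have : b + 1 ≤ n := Finset.mem_range.1 hb
          have h2 : ((b + 1 : ℕ) : ℝ) ≤ n := by exact_mod_cast this
          push_cast at h2
          exact h2.trans (Nat.floor_le (Real.sqrt_nonneg _))
        have hb0 : (0 : ℝ) < b + 1 := by positivity
        have hbN : (b : ℝ) + 1 ≤ N := by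
          nlinarith [Real.sq_sqrt hN0.le, Real.one_le_sqrt.2 hN1]
        have hdiv : 1 ≤ ψ / ((b : ℝ) + 1) ^ s := by
          rw [one_le_div (by positivity), ← hNs]
          gcongr
        have hlog : Real.log ψ / 2 ≤ Real.log (ψ / ((b : ℝ) + 1) ^ s) := by
          rw [Real.log_div hψ0.ne' (by positivity), Real.log_rpow hb0, hL]
          have := Real.log_le_log hb0 hb1
          rw [Real.log_sqrt hN0.le] at this
          nlinarith
        have hpow : (ψ / ((b : ℝ) + 1) ^ s) ^ (1 / s) = N / (b + 1) := by
          rw [Real.div_rpow hψ0.le (by positivity), ← Real.rpow_mul hb0.le,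
            mul_one_div_cancel hs.ne', Real.rpow_one]
        refine le_trans ?_ (mul_le_mul_right (h _ hdiv) _)
        rw [digitWeight, ← ENNReal.ofReal_mul (by positivity), hpow]
        apply ENNReal.ofReal_le_ofReal
        calc c * (Real.log ψ / 2) ^ k / (6 * N) * (1 / ((b : ℝ) + 1))
            = 1 / (6 * ((b : ℝ) + 1) ^ 2) * (c * ((Real.log ψ / 2) ^ k / (N / (b + 1)))) := by
              field_simp
          _ ≤ _ := by
              gcongr 1 / ?_ * (c * (?_ ^ k / _))
              nlinarith [(Nat.cast_nonneg b : (0 : ℝ) ≤ b)]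

lemma exists_tailWeight_ge (m : ℕ) (t : Fin m → ℝ) {s : ℝ} (hs : 0 < s) :
    ∃ c > 0,
      ((Finset.univ.filter fun i => t i = s).card = 0 →
        ∀ ψ ≤ 1, ENNReal.ofReal c ≤ tailWeight m t ψ) ∧
      ∀ k, (Finset.univ.filter fun i => t i = s).card = k + 1 → ∀ ψ, 1 ≤ ψ →
        ENNReal.ofReal (c * (Real.log ψ ^ k / ψ ^ (1 / s))) ≤ tailWeight m t ψ := by
  induction m with
  | zero => exact ⟨1, one_pos, fun _ ψ hψ => by simp [tailWeight, hψ], fun k hk => by simp at hk⟩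
  | succ m ih =>
    obtain ⟨c, hc, h0, h1⟩ := ih (Fin.tail t)
    rw [card_filter_tail]
    by_cases ht : t 0 = s
    · simp only [ht, if_true]
      rcases hl : (Finset.univ.filter fun i => Fin.tail t i = s).card with _ | l
      · refine ⟨c / 24, by positivity, fun h => by omega, fun k hk ψ hψ => ?_⟩
        obtain rfl : k = 0 := by omega
        simpa [mul_one_div, div_eq_mul_inv] using
          tailWeight_succ_ge_of_const hs hc ht (h0 hl) hψ
      · refine ⟨c / (12 * s * 2 ^ l), by positivity, fun h => by omega, fun k hk ψ hψ => ?_⟩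
        obtain rfl : k = l + 1 := by omega
        exact tailWeight_succ_ge_of_log hs hc ht (h1 l hl) hψ
    · simp only [ht, if_false, zero_add]
      refine ⟨1 / 6 * c, by positivity, fun h ψ hψ => ?_, fun k hk ψ hψ => ?_⟩
      · refine le_trans ?_ (mul_tailWeight_le_succ m t ψ)
        rw [ENNReal.ofReal_mul (by positivity)]
        gcongr
        exact h0 h ψ hψ
      · refine le_trans ?_ (mul_tailWeight_le_succ m t ψ)
        rw [mul_assoc, ENNReal.ofReal_mul (by positivity)]
        gcongr
        exact h1 k hk ψ hψ

lemma exists_not_summable_residue {m : ℕ} (hm : 0 < m) {g : ℕ → ℝ} (hg : ∀ n, 0 ≤ g n)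
    (h : ¬ Summable g) : ∃ r, ¬ Summable fun j => g (r + m * j) := by
  by_contra! hr
  have : NeZero m := ⟨hm.ne'⟩
  apply h
  rw [← ((Equiv.prodComm _ _).trans (Nat.divModEquiv m).symm).summable_iff,
    Function.comp_def, summable_prod_of_nonneg (fun _ => hg _)]
  refine ⟨fun r => ?_, Summable.of_finite⟩
  refine (hr r).congr fun j => ?_
  simp [Nat.divModEquiv, add_comm, mul_comm]

theorem stmt_13 (m : ℕ) (hm : 0 < m) (t : Fin m → ℝ) (ht : ∀ i, 0 < t i)
    (Ψ : ℕ → ℝ) (hΨ : ∀ n, 1 ≤ Ψ n)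
    (tmax : ℝ) (htmax : tmax = ⨆ i, t i)
    (ℓ : ℕ) (hℓ : ℓ = (Finset.univ.filter (fun i : Fin m => t i = tmax)).card)
    (hsum : ¬ Summable (fun n : ℕ => (Real.log (Ψ n)) ^ (ℓ - 1) / (Ψ n) ^ (1 / tmax))) :
    MeasureTheory.volume
      (Set.Ico (0 : ℝ) 1 \
        {x ∈ Set.Ico (0 : ℝ) 1 | ∃ᶠ n in Filter.atTop,
          Ψ n ≤ ∏ i : Fin m, ((partQuot x (n + (i : ℕ)) : ℝ)) ^ t i}) = 0 := by
  have : Nonempty (Fin m) := ⟨⟨0, hm⟩⟩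
  obtain ⟨i₀, hi₀⟩ := exists_eq_ciSup_of_finite (f := t)
  have hi : t i₀ = tmax := hi₀.trans htmax.symm
  have hs : 0 < tmax := hi ▸ ht i₀
  have hℓ0 : ℓ ≠ 0 := by
    rw [hℓ]
    exact (Finset.card_pos.2 ⟨i₀, by simp [hi]⟩).ne'
  obtain ⟨k, rfl⟩ := Nat.exists_eq_succ_of_ne_zero hℓ0
  obtain ⟨c, hc, -, hlow⟩ := exists_tailWeight_ge m t hs
  replace hlow := hlow k hℓ.symm
  simp only [Nat.succ_eq_add_one, Nat.add_sub_cancel] at hsum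
  have hg : ∀ n, 0 ≤ Real.log (Ψ n) ^ k / Ψ n ^ (1 / tmax) := fun n => by
    have h1 := Real.log_nonneg (hΨ n)
    have h2 : 0 ≤ Ψ n := zero_le_one.trans (hΨ n)
    positivity
  obtain ⟨r, hr⟩ := exists_not_summable_residue hm hg hsum
  have hdiv : ∀ J, ∑' j, tailWeight m t (Ψ (r + m * (j + J))) = ∞ := fun J => by
    by_contra hfin
    have hc_summable : Summable fun j =>
        c * (Real.log (Ψ (r + m * (j + J))) ^ k / Ψ (r + m * (j + J)) ^ (1 / tmax)) :=
      (ENNReal.summable_toReal hfin).of_nonneg_of_le (fun j => mul_nonneg hc.le (hg _))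
        fun j => (ENNReal.ofReal_le_iff_le_toReal (ENNReal.ne_top_of_tsum_ne_top hfin j)).1
          (hlow _ (hΨ _))
    exact hr ((summable_nat_add_iff J).1 ((summable_mul_left_iff hc.ne').1 hc_summable))
  set A : ℕ → Set ℝ := fun J => gaussMap^[r + m * (J + 1) - 1] ⁻¹'
    {x | ∀ j, digitProd m t (gaussMap^[m * j] x) < Ψ (r + m * (j + (J + 1)))}
  have hAmeas : ∀ J, MeasurableSet (A J) := fun J => by
    refine (measurable_gaussMap.iterate _) ?_
    simp only [ofPred_forall]
    exact MeasurableSet.iInter fun j => measurableSet_lt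
      ((measurable_digitProd m t).comp (measurable_gaussMap.iterate _)) measurable_const
  have hA : ∀ J, volume (A J ∩ Ico (0 : ℝ) 1) = 0 := fun J =>
    volume_inter_eq_zero (hAmeas J) (mobiusMass_preimage_iterate_eq_zero
      (fun θ hθ => mobiusMass_forall_eq_zero m t _ (hdiv (J + 1)) hθ) _ ⟨le_rfl, zero_le_one⟩)
  refine measure_mono_null ?_ (measure_iUnion_null hA)
  rintro x ⟨hx, hx'⟩
  simp only [mem_ofPred_eq, hx, true_and, not_frequently, eventually_atTop, not_le] at hx'
  obtain ⟨J, hJ⟩ := hx'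
  refine mem_iUnion.2 ⟨J, fun j => ?_, hx⟩
  have hle : J + 1 ≤ m * (J + 1) := Nat.le_mul_of_pos_left _ hm
  have hexp : m * (j + (J + 1)) = m * j + m * (J + 1) := Nat.mul_add _ _ _
  refine lt_of_eq_of_lt ?_ (hJ (r + m * (j + (J + 1))) (by omega))
  refine Finset.prod_congr rfl fun i _ => ?_
  rw [partQuot, ← Function.iterate_add_apply, ← Function.iterate_add_apply]
  congr 6
  omega
end

section
/- For any reals b, c > 1, the set of x ∈ [0,1) such that a_n(x) ≥ c^{b^n} for infinitely many n and the set of x ∈ [0,1) such that a_n(x) ≥ c^{b^n} for all n ≥ 1 have the same Hausdorff dimension, equal to 1/(b+1). -/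
open Filter MeasureTheory

/-! ### Partial quotients and the Gauss map -/

theorem gaussMap_mem_Ico (x : ℝ) : gaussMap x ∈ Set.Ico (0 : ℝ) 1 :=
  ⟨Int.fract_nonneg _, Int.fract_lt_one _⟩

theorem gaussMap_iterate_mem_Ico {x : ℝ} (hx : x ∈ Set.Ico (0 : ℝ) 1) (n : ℕ) :
    gaussMap^[n] x ∈ Set.Ico (0 : ℝ) 1 := by
  cases n with
  | zero => exact hx
  | succ n =>
    rw [Function.iterate_succ_apply']
    exact gaussMap_mem_Ico _

theorem partQuot_succ (x : ℝ) (n : ℕ) : partQuot x (n + 1) = ⌊1 / gaussMap^[n] x⌋₊ := rfl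

theorem gaussMap_iterate_eq_zero {x : ℝ} {m n : ℕ} (hmn : m ≤ n) (h : gaussMap^[m] x = 0) :
    gaussMap^[n] x = 0 := by
  induction n, hmn using Nat.le_induction with
  | base => exact h
  | succ n _ ih => rw [Function.iterate_succ_apply', ih]; simp [gaussMap]

theorem gaussMap_iterate_mul_partQuot_add {x : ℝ} {n : ℕ}
    (h : gaussMap^[n] x ∈ Set.Ioo (0 : ℝ) 1) :
    gaussMap^[n] x * ((partQuot x (n + 1) : ℝ) + gaussMap^[n + 1] x) = 1 := by
  rw [Function.iterate_succ_apply', partQuot_succ, gaussMap,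
    natCast_floor_eq_intCast_floor (one_div_pos.2 h.1).le, Int.floor_add_fract,
    mul_one_div_cancel h.1.ne']

theorem one_le_partQuot_succ {x : ℝ} {n : ℕ} (h : gaussMap^[n] x ∈ Set.Ioo (0 : ℝ) 1) :
    1 ≤ partQuot x (n + 1) := by
  rw [partQuot_succ]
  exact Nat.le_floor (by rw [Nat.cast_one]; exact one_le_one_div h.1 h.2.le)

theorem gaussMap_iterate_mem_Ioo {x : ℝ} (hx : x ∈ Set.Ico (0 : ℝ) 1)
    (h : ∃ᶠ n in atTop, 0 < partQuot x n) (n : ℕ) : gaussMap^[n] x ∈ Set.Ioo (0 : ℝ) 1 := by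
  have hm := gaussMap_iterate_mem_Ico hx n
  refine ⟨lt_of_le_of_ne hm.1 fun h0 => ?_, hm.2⟩
  obtain ⟨k, hk, hpos⟩ := frequently_atTop.1 h (n + 1)
  rw [partQuot, gaussMap_iterate_eq_zero (by omega) h0.symm] at hpos
  simp at hpos

/-- Two continued fraction expansions sharing their first `n` partial quotients. -/
theorem abs_sub_eq_prod_mul_abs_sub {z w a : ℕ → ℝ} {n : ℕ}
    (hz : ∀ k < n, 0 < z k) (hw : ∀ k < n, 0 < w k)
    (hza : ∀ k < n, z k * (a k + z (k + 1)) = 1) (hwa : ∀ k < n, w k * (a k + w (k + 1)) = 1) :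
    |z 0 - w 0| = (∏ k ∈ Finset.range n, z k * w k) * |z n - w n| := by
  induction n with
  | zero => simp
  | succ n ih =>
    have h : z n - w n = z n * w n * (w (n + 1) - z (n + 1)) := by
      linear_combination w n * hza n n.lt_succ_self - z n * hwa n n.lt_succ_self
    rw [ih (fun k hk => hz k (by omega)) (fun k hk => hw k (by omega))
      (fun k hk => hza k (by omega)) (fun k hk => hwa k (by omega)), Finset.prod_range_succ, h,
      abs_mul, abs_of_pos (mul_pos (hz n n.lt_succ_self) (hw n n.lt_succ_self)), abs_sub_comm,
      ← mul_assoc]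

/-! ### The upper bound -/

/-- The points whose first `n` partial quotients are `w i + 1` and whose next partial quotient is
large compared with both their product and `d ^ n`. -/
def growthCylinder (d : ℝ) (n : ℕ) (w : Fin n → ℕ) : Set ℝ :=
  {x | (∀ k ≤ n, gaussMap^[k] x ∈ Set.Ioo (0 : ℝ) 1) ∧
    (∀ k : Fin n, partQuot x (k + 1) = w k + 1) ∧
    d * max (Real.log (∏ k, ((w k : ℝ) + 1))) (d ^ n) ≤
      Real.log ((∏ k, ((w k : ℝ) + 1)) * partQuot x (n + 1))}

theorem gaussMap_iterate_le_of_mem_growthCylinder {d : ℝ} {n : ℕ} {w : Fin n → ℕ} {x : ℝ}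
    (hx : x ∈ growthCylinder d n w) :
    gaussMap^[n] x ≤ (∏ k, ((w k : ℝ) + 1)) *
      Real.exp (-(d * max (Real.log (∏ k, ((w k : ℝ) + 1))) (d ^ n))) := by
  obtain ⟨h1, -, h3⟩ := hx
  set P : ℝ := ∏ k, ((w k : ℝ) + 1)
  have hP : 0 < P := Finset.prod_pos fun k _ => by positivity
  have hq : (0 : ℝ) < partQuot x (n + 1) := by
    exact_mod_cast one_le_partQuot_succ (h1 n le_rfl)
  rw [Real.le_log_iff_exp_le (mul_pos hP hq)] at h3
  rw [Real.exp_neg, ← div_eq_mul_inv, le_div_iff₀ (Real.exp_pos _)]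
  have hz := h1 n le_rfl
  have hz' := (gaussMap_mem_Ico (gaussMap^[n] x)).1
  rw [← Function.iterate_succ_apply' gaussMap] at hz'
  have hmul := gaussMap_iterate_mul_partQuot_add hz
  calc _ ≤ gaussMap^[n] x * (P * partQuot x (n + 1)) := by gcongr; exact hz.1.le
    _ = P * (gaussMap^[n] x * partQuot x (n + 1)) := by ring
    _ ≤ P * 1 := by
      gcongr
      nlinarith [mul_nonneg hz.1.le hz']
    _ = P := mul_one P

theorem ediam_growthCylinder_le (d : ℝ) (n : ℕ) (w : Fin n → ℕ) :
    Metric.ediam (growthCylinder d n w) ≤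
      ENNReal.ofReal (Real.exp (-(Real.log (∏ k, ((w k : ℝ) + 1)) +
        d * max (Real.log (∏ k, ((w k : ℝ) + 1))) (d ^ n)))) := by
  refine Metric.ediam_le_of_forall_dist_le fun x hx y hy => ?_
  have hxn := gaussMap_iterate_le_of_mem_growthCylinder hx
  have hyn := gaussMap_iterate_le_of_mem_growthCylinder hy
  obtain ⟨hx1, hx2, -⟩ := hx
  obtain ⟨hy1, hy2, -⟩ := hy
  set P : ℝ := ∏ k, ((w k : ℝ) + 1) with hPdef
  have hP : 0 < P := Finset.prod_pos fun k _ => by positivity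
  set D := d * max (Real.log P) (d ^ n)
  have hxy : ∀ k < n, partQuot y (k + 1) = partQuot x (k + 1) := fun k hk =>
    (hy2 ⟨k, hk⟩).trans (hx2 ⟨k, hk⟩).symm
  have hmain := abs_sub_eq_prod_mul_abs_sub (z := fun k => gaussMap^[k] x)
    (w := fun k => gaussMap^[k] y) (a := fun k => partQuot x (k + 1)) (n := n)
    (fun k hk => (hx1 k hk.le).1) (fun k hk => (hy1 k hk.le).1)
    (fun k hk => gaussMap_iterate_mul_partQuot_add (hx1 k hk.le))
    (fun k hk => by
      have := gaussMap_iterate_mul_partQuot_add (hy1 k hk.le)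
      rwa [hxy k hk] at this)
  have hle : ∀ v : ℝ, (∀ k ≤ n, gaussMap^[k] v ∈ Set.Ioo (0 : ℝ) 1) →
      (∀ k : Fin n, partQuot v (k + 1) = w k + 1) → ∀ k : Fin n,
      gaussMap^[k] v ≤ ((w k : ℝ) + 1)⁻¹ := by
    intro v h1 h2 k
    have hz := h1 k k.2.le
    have hz' := (gaussMap_mem_Ico (gaussMap^[k] v)).1
    rw [← Function.iterate_succ_apply' gaussMap] at hz'
    have hmul := gaussMap_iterate_mul_partQuot_add hz
    rw [h2 k] at hmul
    push_cast at hmul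
    rw [← one_div, le_div_iff₀ (by positivity)]
    nlinarith [mul_nonneg hz.1.le hz']
  have hprod : ∏ k ∈ Finset.range n, gaussMap^[k] x * gaussMap^[k] y ≤ P⁻¹ * P⁻¹ := by
    rw [Finset.prod_range, hPdef, ← Finset.prod_inv_distrib, ← Finset.prod_mul_distrib]
    refine Finset.prod_le_prod (fun k _ => ?_) fun k _ => ?_
    · exact mul_nonneg (hx1 k k.2.le).1.le (hy1 k k.2.le).1.le
    · exact mul_le_mul (hle x hx1 hx2 k) (hle y hy1 hy2 k) (hy1 k k.2.le).1.le (by positivity)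
  have hlast : |gaussMap^[n] x - gaussMap^[n] y| ≤ P * Real.exp (-D) := by
    rw [abs_sub_le_iff]
    constructor <;> linarith [(hx1 n le_rfl).1, (hy1 n le_rfl).1]
  calc dist x y = _ := hmain
    _ ≤ P⁻¹ * P⁻¹ * (P * Real.exp (-D)) := by gcongr
    _ = Real.exp (-(Real.log P + D)) := by
      rw [neg_add, Real.exp_add, Real.exp_neg (Real.log P), Real.exp_log hP]
      field_simp

theorem tsum_prod_eq_pow (f : ℕ → ENNReal) (n : ℕ) :
    ∑' w : Fin n → ℕ, ∏ k, f (w k) = (∑' j, f j) ^ n := by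
  induction n with
  | zero => simp
  | succ n ih =>
    rw [← (Fin.consEquiv fun _ : Fin (n + 1) => ℕ).tsum_eq, pow_succ', ← ih,
      ← ENNReal.tsum_mul_right]
    simp_rw [← ENNReal.tsum_mul_left]
    rw [← ENNReal.tsum_prod]
    refine tsum_congr fun p => ?_
    rw [Fin.prod_univ_succ]
    rfl

theorem ediam_growthCylinder_rpow_le {d s δ : ℝ} (hs : 0 < s) (hδ : 0 ≤ δ)
    (hδ' : δ ≤ s * d) (n : ℕ) (w : Fin n → ℕ) :
    Metric.ediam (growthCylinder d n w) ^ s ≤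
      (∏ k, ENNReal.ofReal (((w k : ℝ) + 1) ^ (-(s + s * d - δ)))) *
        ENNReal.ofReal (Real.exp (-(δ * d ^ n))) := by
  refine (ENNReal.rpow_le_rpow (ediam_growthCylinder_le d n w) hs.le).trans ?_
  rw [ENNReal.ofReal_rpow_of_pos (Real.exp_pos _),
    ← ENNReal.ofReal_prod_of_nonneg (fun k _ => by positivity),
    ← ENNReal.ofReal_mul (Finset.prod_nonneg fun k _ => by positivity)]
  refine ENNReal.ofReal_le_ofReal ?_
  rw [Real.finsetProd_rpow _ _ fun k _ => by positivity]
  set P : ℝ := ∏ k, ((w k : ℝ) + 1) with hPdef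
  have hP : 0 < P := Finset.prod_pos fun k _ => by positivity
  rw [Real.rpow_def_of_pos hP, ← Real.exp_mul, ← Real.exp_add, Real.exp_le_exp]
  have h1 := mul_le_mul_of_nonneg_left (le_max_left (Real.log P) (d ^ n)) (sub_nonneg.2 hδ')
  have h2 := mul_le_mul_of_nonneg_left (le_max_right (Real.log P) (d ^ n)) hδ
  linarith

theorem summable_pow_mul_exp_neg {Z d δ : ℝ} (hZ : 0 < Z) (hd : 1 < d) (hδ : 0 < δ) :
    Summable fun n : ℕ => Z ^ n * Real.exp (-(δ * d ^ n)) := by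
  refine summable_of_ratio_test_tendsto_lt_one zero_lt_one
    (Eventually.of_forall fun n => by positivity) ?_
  have h : ∀ n : ℕ, ‖Z ^ (n + 1) * Real.exp (-(δ * d ^ (n + 1)))‖ /
      ‖Z ^ n * Real.exp (-(δ * d ^ n))‖ = Z * Real.exp (-(δ * (d - 1) * d ^ n)) := by
    intro n
    rw [Real.norm_of_nonneg (by positivity), Real.norm_of_nonneg (by positivity),
      div_eq_iff (by positivity), mul_mul_mul_comm, ← Real.exp_add, ← pow_succ']
    ring_nf
  simp_rw [h]
  rw [← mul_zero Z]
  refine Tendsto.const_mul Z (Real.tendsto_exp_neg_atTop_nhds_zero.comp ?_)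
  exact (tendsto_pow_atTop_atTop_of_one_lt hd).const_mul_atTop (mul_pos hδ (sub_pos.2 hd))

/-- Infinitely many very large partial quotients force infinitely many superlinear jumps of the
logarithm of the product of the partial quotients. -/
theorem frequently_jump {b c d : ℝ} (hd : 1 < d) (hdb : d < b) (hc : 1 < c) {q : ℕ → ℕ}
    (hq : ∀ n, 1 ≤ q n) (h : ∃ᶠ n in atTop, c ^ (b ^ (n + 1)) ≤ (q n : ℝ)) :
    ∃ᶠ n in atTop, d * max (Real.log (∏ k ∈ Finset.range n, (q k : ℝ))) (d ^ n) ≤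
      Real.log (∏ k ∈ Finset.range (n + 1), (q k : ℝ)) := by
  intro hcon
  simp only [not_le] at hcon
  obtain ⟨N, hN⟩ := eventually_atTop.1 hcon
  have hb0 : 0 < b := by linarith
  set S : ℕ → ℝ := fun n => Real.log (∏ k ∈ Finset.range n, (q k : ℝ)) with hS
  have hd0 : 0 < d := by linarith
  set C := max (S N) (d ^ N) / d ^ N with hC
  have hbd : ∀ n, N ≤ n → max (S n) (d ^ n) ≤ C * d ^ n := by
    intro n hn
    induction n, hn using Nat.le_induction with
    | base => rw [hC, div_mul_cancel₀ _ (by positivity)]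
    | succ n hn ih =>
      have : C * d ^ (n + 1) = d * (C * d ^ n) := by ring
      rw [this]
      refine max_le ((hN n hn).le.trans (by gcongr)) ?_
      rw [pow_succ']
      gcongr
      exact (le_max_right _ _).trans ih
  have hlog : 0 < Real.log c := Real.log_pos hc
  have htend : Tendsto (fun n : ℕ => C * (d / b) ^ (n + 1)) atTop (nhds 0) := by
    rw [← mul_zero C]
    refine ((tendsto_pow_atTop_nhds_zero_of_lt_one (by positivity) ?_).comp
      (tendsto_add_atTop_nat 1)).const_mul C
    exact (div_lt_one (by linarith)).2 hdb
  obtain ⟨n, hn, hlt, hNn⟩ :=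
    (h.and_eventually ((htend.eventually_lt_const hlog).and (eventually_ge_atTop N))).exists
  have hqpos : ∀ k, (1 : ℝ) ≤ q k := fun k => by exact_mod_cast hq k
  have h1 : b ^ (n + 1) * Real.log c ≤ S (n + 1) := by
    rw [← Real.log_rpow (by linarith)]
    refine Real.log_le_log (by positivity) (hn.trans ?_)
    rw [Finset.prod_range_succ]
    refine le_mul_of_one_le_left (by linarith [hqpos n]) ?_
    exact Finset.one_le_prod fun k _ => hqpos k
  have h2 := (le_max_left _ _).trans (hbd (n + 1) (by omega))
  rw [div_pow, ← mul_div_assoc, div_lt_iff₀ (by positivity)] at hlt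
  linarith

theorem subset_iUnion_growthCylinder {b c d : ℝ} (hd : 1 < d) (hdb : d < b) (hc : 1 < c) (m : ℕ) :
    {x ∈ Set.Ico (0 : ℝ) 1 | ∃ᶠ n in atTop, c ^ (b ^ n) ≤ (partQuot x n : ℝ)} ⊆
      ⋃ p : Σ n : ℕ, Fin n → ℕ, if m ≤ p.1 then growthCylinder d p.1 p.2 else ∅ := by
  rintro x ⟨hx, hfreq⟩
  have hmem := gaussMap_iterate_mem_Ioo hx (hfreq.mono fun n hn => by
    have : 0 < c ^ (b ^ n) := by positivity
    exact_mod_cast this.trans_le hn)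
  have hq : ∀ n, 1 ≤ partQuot x (n + 1) := fun n => one_le_partQuot_succ (hmem n)
  have hfreq' : ∃ᶠ n in atTop, c ^ (b ^ (n + 1)) ≤ (partQuot x (n + 1) : ℝ) := by
    rw [frequently_atTop] at hfreq ⊢
    intro k
    obtain ⟨n, hn, h⟩ := hfreq (k + 1)
    obtain ⟨n, rfl⟩ := Nat.exists_eq_add_of_le' (show 1 ≤ n by omega)
    exact ⟨n, by omega, h⟩
  obtain ⟨n, hmn, hn⟩ := frequently_atTop.1 (frequently_jump hd hdb hc hq hfreq') m
  refine Set.mem_iUnion.2 ⟨⟨n, fun k => partQuot x (k + 1) - 1⟩, ?_⟩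
  rw [if_pos hmn]
  have hcast : ∀ k : ℕ, ((partQuot x (k + 1) - 1 : ℕ) : ℝ) + 1 = partQuot x (k + 1) := by
    intro k
    rw [Nat.cast_sub (hq k)]
    simp
  refine ⟨fun k _ => hmem k, fun k => (Nat.sub_add_cancel (hq k)).symm, ?_⟩
  simp only [hcast]
  rwa [Finset.prod_range_succ, Finset.prod_range] at hn

theorem hausdorffMeasure_frequently_lt_top {b c d s : ℝ} (hd : 1 < d) (hdb : d < b) (hc : 1 < c)
    (hs : 0 < s) (hsd : 1 < s + s * d) :
    μH[s] {x ∈ Set.Ico (0 : ℝ) 1 | ∃ᶠ n in atTop, c ^ (b ^ n) ≤ (partQuot x n : ℝ)} < ⊤ := by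
  obtain ⟨δ, hδ, hδ'⟩ : ∃ δ, 0 < δ ∧ δ < min (s * d) (s + s * d - 1) :=
    exists_between (lt_min (by nlinarith) (by linarith))
  rw [lt_min_iff] at hδ'
  set p := s + s * d - δ with hp
  have hsum : Summable fun j : ℕ => ((j : ℝ) + 1) ^ (-p) := by
    have := (summable_nat_add_iff 1).2 (Real.summable_nat_rpow_inv.2 (show 1 < p by linarith))
    refine this.congr fun j => ?_
    rw [Real.rpow_neg (by positivity)]
    push_cast
    rfl
  set Z := ∑' j : ℕ, ((j : ℝ) + 1) ^ (-p)
  have hZ : 0 < Z := hsum.tsum_pos (fun j => by positivity) 0 (by positivity)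
  have hcover := Measure.hausdorffMeasure_le_liminf_tsum s
    {x ∈ Set.Ico (0 : ℝ) 1 | ∃ᶠ n in atTop, c ^ (b ^ n) ≤ (partQuot x n : ℝ)} (l := atTop)
    (fun m : ℕ => ENNReal.ofReal (Real.exp (-(d * d ^ m))))
    (by
      rw [← ENNReal.ofReal_zero]
      refine ENNReal.tendsto_ofReal (Real.tendsto_exp_neg_atTop_nhds_zero.comp ?_)
      exact (tendsto_pow_atTop_atTop_of_one_lt hd).const_mul_atTop (by linarith))
    (fun (m : ℕ) (p : Σ n : ℕ, Fin n → ℕ) => if m ≤ p.1 then growthCylinder d p.1 p.2 else ∅)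
    (Eventually.of_forall fun m p => by
      split_ifs with hm
      · refine (ediam_growthCylinder_le d p.1 p.2).trans (ENNReal.ofReal_le_ofReal ?_)
        rw [Real.exp_le_exp, neg_le_neg_iff]
        have h1 : 0 ≤ Real.log (∏ k, ((p.2 k : ℝ) + 1)) :=
          Real.log_nonneg (Finset.one_le_prod fun k => by simp)
        have h2 : d ^ m ≤ d ^ p.1 := pow_le_pow_right₀ hd.le hm
        have h3 := h2.trans (le_max_right (Real.log (∏ k, ((p.2 k : ℝ) + 1))) _)
        nlinarith
      · simp)
    (Eventually.of_forall fun m => subset_iUnion_growthCylinder hd hdb hc m)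
  refine hcover.trans_lt ?_
  have hbound : ∀ m : ℕ, ∑' p : Σ n : ℕ, Fin n → ℕ,
      Metric.ediam (if m ≤ p.1 then growthCylinder d p.1 p.2 else ∅) ^ s ≤
      ∑' n : ℕ, ENNReal.ofReal (Z ^ n * Real.exp (-(δ * d ^ n))) := by
    intro m
    calc _ ≤ ∑' q : Σ n : ℕ, Fin n → ℕ, (∏ k, ENNReal.ofReal (((q.2 k : ℝ) + 1) ^ (-p))) *
          ENNReal.ofReal (Real.exp (-(δ * d ^ q.1))) := by
          refine ENNReal.tsum_le_tsum fun q => ?_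
          split_ifs
          · exact ediam_growthCylinder_rpow_le hs hδ.le hδ'.1.le q.1 q.2
          · simp [hs]
      _ = _ := by
          rw [ENNReal.tsum_sigma' _]
          refine tsum_congr fun n => ?_
          dsimp only
          rw [ENNReal.tsum_mul_right,
            tsum_prod_eq_pow fun j : ℕ => ENNReal.ofReal (((j : ℝ) + 1) ^ (-p)),
            ← ENNReal.ofReal_tsum_of_nonneg (fun j => by positivity) hsum,
            ← ENNReal.ofReal_pow hZ.le, ← ENNReal.ofReal_mul (by positivity)]
  refine (liminf_le_of_frequently_le' (Frequently.of_forall hbound)).trans_lt ?_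
  exact (summable_pow_mul_exp_neg hZ hd hδ).tsum_ofReal_ne_top.lt_top

theorem dimH_frequently_le {b c : ℝ} (hb : 1 < b) (hc : 1 < c) :
    dimH {x ∈ Set.Ico (0 : ℝ) 1 | ∃ᶠ n in atTop, c ^ (b ^ n) ≤ (partQuot x n : ℝ)} ≤
      ENNReal.ofReal (1 / (b + 1)) := by
  refine le_of_forall_gt fun s' hs' => ?_
  obtain ⟨s, hs, hss'⟩ := ENNReal.lt_iff_exists_nnreal_btwn.1 hs'
  refine lt_of_le_of_lt ?_ hss'
  have hs1 : 1 / (b + 1) < (s : ℝ) := by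
    rw [← ENNReal.ofReal_coe_nnreal, ENNReal.ofReal_lt_ofReal_iff'] at hs
    exact hs.1
  have hs0 : 0 < (s : ℝ) := lt_trans (by positivity) hs1
  rw [div_lt_iff₀ (by linarith)] at hs1
  obtain ⟨d, hd, hdb⟩ : ∃ d : ℝ, max 1 ((1 - (s : ℝ)) / s) < d ∧ d < b :=
    exists_between (max_lt hb (by rw [div_lt_iff₀ hs0]; linarith))
  rw [max_lt_iff, div_lt_iff₀ hs0] at hd
  exact dimH_le_of_hausdorffMeasure_ne_top
    (hausdorffMeasure_frequently_lt_top hd.1 hdb hc hs0 (by linarith)).ne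

/-! ### Cantor series -/

/-- The orbit of `t` under the mixed radix maps `x ↦ fract (N k * x)`. -/
noncomputable def radixTail (N : ℕ → ℕ) (t : ℝ) : ℕ → ℝ
  | 0 => t
  | k + 1 => Int.fract (N k * radixTail N t k)

/-- The digits of `t` in the mixed radix system with bases `N k`. -/
noncomputable def radixDigit (N : ℕ → ℕ) (t : ℝ) (k : ℕ) : ℕ := ⌊N k * radixTail N t k⌋₊

theorem radixTail_mem_Ico (N : ℕ → ℕ) {t : ℝ} (ht : t ∈ Set.Ico (0 : ℝ) 1) (k : ℕ) :
    radixTail N t k ∈ Set.Ico (0 : ℝ) 1 := by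
  cases k with
  | zero => exact ht
  | succ k => exact ⟨Int.fract_nonneg _, Int.fract_lt_one _⟩

theorem mul_radixTail (N : ℕ → ℕ) {t : ℝ} (ht : t ∈ Set.Ico (0 : ℝ) 1) (k : ℕ) :
    N k * radixTail N t k = radixDigit N t k + radixTail N t (k + 1) := by
  rw [radixDigit, natCast_floor_eq_intCast_floor
    (mul_nonneg (Nat.cast_nonneg _) (radixTail_mem_Ico N ht k).1), radixTail, Int.floor_add_fract]

theorem radixDigit_lt {N : ℕ → ℕ} (hN : ∀ k, 0 < N k) {t : ℝ} (ht : t ∈ Set.Ico (0 : ℝ) 1)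
    (k : ℕ) : radixDigit N t k < N k := by
  have h := radixTail_mem_Ico N ht k
  have hk : (0 : ℝ) < N k := by exact_mod_cast hN k
  rw [radixDigit, Nat.floor_lt (mul_nonneg hk.le h.1)]
  exact mul_lt_of_lt_one_right hk h.2

theorem prod_mul_abs_sub_eq {N : ℕ → ℕ} {t u : ℝ} (ht : t ∈ Set.Ico (0 : ℝ) 1)
    (hu : u ∈ Set.Ico (0 : ℝ) 1) {n : ℕ} (h : ∀ k < n, radixDigit N t k = radixDigit N u k) :
    (∏ k ∈ Finset.range n, (N k : ℝ)) * |t - u| = |radixTail N t n - radixTail N u n| := by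
  induction n with
  | zero => simp [radixTail]
  | succ n ih =>
    have h1 := mul_radixTail N ht n
    have h2 := mul_radixTail N hu n
    rw [h n n.lt_succ_self] at h1
    rw [Finset.prod_range_succ, mul_right_comm, ih fun k hk => h k (by omega), mul_comm,
      ← Nat.abs_cast (N n), ← abs_mul]
    congr 1
    linarith

theorem exists_radixDigit_ne {N : ℕ → ℕ} (hN : ∀ k, 2 ≤ N k) {t u : ℝ}
    (ht : t ∈ Set.Ico (0 : ℝ) 1) (hu : u ∈ Set.Ico (0 : ℝ) 1) (htu : t ≠ u) :
    ∃ n, radixDigit N t n ≠ radixDigit N u n := by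
  by_contra! h
  have hpos : 0 < |t - u| := abs_pos.2 (sub_ne_zero.2 htu)
  obtain ⟨n, hn⟩ := pow_unbounded_of_one_lt (1 / |t - u|) (one_lt_two (α := ℝ))
  have h1 := prod_mul_abs_sub_eq ht hu fun k (_ : k < n) => h k
  have h2 : (2 : ℝ) ^ n ≤ ∏ k ∈ Finset.range n, (N k : ℝ) := by
    calc (2 : ℝ) ^ n = ∏ _k ∈ Finset.range n, (2 : ℝ) := by simp
      _ ≤ _ := Finset.prod_le_prod (fun _ _ => by norm_num) fun k _ => by exact_mod_cast hN k
  have h3 := radixTail_mem_Ico N ht n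
  have h4 := radixTail_mem_Ico N hu n
  have h5 : |radixTail N t n - radixTail N u n| < 1 := by
    rw [abs_sub_lt_iff]
    constructor <;> linarith [h3.1, h3.2, h4.1, h4.2]
  rw [div_lt_iff₀ hpos] at hn
  nlinarith

theorem prod_mul_abs_sub_le {N : ℕ → ℕ} {t u : ℝ} (ht : t ∈ Set.Ico (0 : ℝ) 1)
    (hu : u ∈ Set.Ico (0 : ℝ) 1) {n : ℕ} (h : ∀ k < n, radixDigit N t k = radixDigit N u k)
    (hn : 1 ≤ |(radixDigit N t n : ℝ) - radixDigit N u n|) :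
    (∏ k ∈ Finset.range n, (N k : ℝ)) * N n * |t - u| ≤
      2 * |(radixDigit N t n : ℝ) - radixDigit N u n| := by
  rw [mul_right_comm, prod_mul_abs_sub_eq ht hu h, mul_comm, ← Nat.abs_cast (N n), ← abs_mul,
    mul_sub, mul_radixTail N ht, mul_radixTail N hu, add_sub_add_comm]
  have h3 := radixTail_mem_Ico N ht (n + 1)
  have h4 := radixTail_mem_Ico N hu (n + 1)
  have h5 : |radixTail N t (n + 1) - radixTail N u (n + 1)| ≤ 1 := by
    rw [abs_sub_le_iff]
    constructor <;> linarith [h3.1, h3.2, h4.1, h4.2]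
  linarith [abs_add_le ((radixDigit N t n : ℝ) - radixDigit N u n)
    (radixTail N t (n + 1) - radixTail N u (n + 1))]

/-! ### Continued fractions with prescribed partial quotients -/

theorem exists_continuedFraction_tails (a : ℕ → ℕ) (ha : ∀ k, 1 ≤ a k) :
    ∃ z : ℕ → ℝ, ∀ k, z k ∈ Set.Ioo (0 : ℝ) 1 ∧ z k * (a k + z (k + 1)) = 1 := by
  have ha' : ∀ k, (1 : ℝ) ≤ a k := fun k => by exact_mod_cast ha k
  set T : ℕ → Set (ℕ → ℝ) := fun m =>
    {z | z ∈ Set.Icc 0 1 ∧ ∀ k < m, z k * (a k + z (k + 1)) = 1}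
  have hclosed : ∀ m, IsClosed (T m) := by
    intro m
    have hT : T m = Set.Icc 0 1 ∩
        ⋂ k, ⋂ (_ : k < m), {z : ℕ → ℝ | z k * (a k + z (k + 1)) = 1} := by
      ext z
      simp [T]
    rw [hT]
    exact isClosed_Icc.inter <| isClosed_iInter fun k => isClosed_iInter fun _ =>
      isClosed_eq (by fun_prop) continuous_const
  have hne : ∀ m, ∀ a : ℕ → ℕ, (∀ k, (1 : ℝ) ≤ a k) →
      ∃ z : ℕ → ℝ, z ∈ Set.Icc 0 1 ∧ ∀ k < m, z k * (a k + z (k + 1)) = 1 := by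
    intro m
    induction m with
    | zero => exact fun _ _ => ⟨0, ⟨le_rfl, zero_le_one⟩, by simp⟩
    | succ m ih =>
      intro a ha
      obtain ⟨z, hz, hza⟩ := ih (fun k => a (k + 1)) fun k => ha (k + 1)
      have h0 : (1 : ℝ) ≤ a 0 + z 0 := by linarith [ha 0, show (0 : ℝ) ≤ z 0 from hz.1 0]
      refine ⟨fun k => Nat.casesOn k (1 / (a 0 + z 0)) z, ⟨?_, ?_⟩, ?_⟩
      · rintro (_ | k)
        · exact one_div_nonneg.2 (by linarith)
        · exact hz.1 k
      · rintro (_ | k)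
        · exact div_le_one_of_le₀ h0 (by linarith)
        · exact hz.2 k
      · rintro (_ | k) hk
        · exact one_div_mul_cancel (by linarith)
        · exact hza k (by omega)
  obtain ⟨z, hz⟩ := IsCompact.nonempty_iInter_of_sequence_nonempty_isCompact_isClosed T
    (fun m z hz => ⟨hz.1, fun k hk => hz.2 k (by omega)⟩) (fun m => hne m a ha')
    (isCompact_Icc.of_isClosed_subset (hclosed 0) fun z hz => hz.1) hclosed
  rw [Set.mem_iInter] at hz
  have hrec : ∀ k, z k * (a k + z (k + 1)) = 1 := fun k => (hz (k + 1)).2 k k.lt_succ_self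
  have hnn : ∀ k, 0 ≤ z k := fun k => (hz 0).1.1 k
  have hpos : ∀ k, 0 < z k := fun k => (hnn k).lt_of_ne fun h => by
    simpa [← h] using hrec k
  refine ⟨z, fun k => ⟨⟨hpos k, ?_⟩, hrec k⟩⟩
  nlinarith [hrec k, hpos k, hpos (k + 1), ha' k, mul_pos (hpos k) (hpos (k + 1))]

section Tails

variable {a : ℕ → ℕ} {z : ℕ → ℝ}

theorem gaussMap_iterate_of_tails
    (hz : ∀ k, z k ∈ Set.Ioo (0 : ℝ) 1 ∧ z k * (a k + z (k + 1)) = 1) (k : ℕ) :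
    gaussMap^[k] (z 0) = z k := by
  induction k with
  | zero => rfl
  | succ k ih =>
    have h : 1 / z k = a k + z (k + 1) := by
      rw [div_eq_iff (hz k).1.1.ne', mul_comm, (hz k).2]
    rw [Function.iterate_succ_apply', ih, gaussMap, h, Int.fract_natCast_add,
      Int.fract_eq_self.2 ⟨(hz (k + 1)).1.1.le, (hz (k + 1)).1.2⟩]

theorem partQuot_of_tails
    (hz : ∀ k, z k ∈ Set.Ioo (0 : ℝ) 1 ∧ z k * (a k + z (k + 1)) = 1) (k : ℕ) :
    partQuot (z 0) (k + 1) = a k := by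
  have h : 1 / z k = a k + z (k + 1) := by
    rw [div_eq_iff (hz k).1.1.ne', mul_comm, (hz k).2]
  rw [partQuot_succ, gaussMap_iterate_of_tails hz, h, Nat.floor_eq_iff]
  · constructor <;> linarith [(hz (k + 1)).1.1, (hz (k + 1)).1.2]
  · have := (hz (k + 1)).1.1
    positivity

theorem tail_bounds {N : ℕ → ℕ} (hN : ∀ k, 2 ≤ N k) (ha : ∀ k, N k ≤ a k ∧ a k < 2 * N k)
    (hz : ∀ k, z k ∈ Set.Ioo (0 : ℝ) 1 ∧ z k * (a k + z (k + 1)) = 1) (k : ℕ) :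
    (2 * (N k : ℝ))⁻¹ ≤ z k ∧ z k ≤ 1 / 2 := by
  have h1 : (a k : ℝ) + 1 ≤ 2 * N k := by exact_mod_cast (ha k).2
  have h2 : (2 : ℝ) ≤ a k := by exact_mod_cast (hN k).trans (ha k).1
  have h3 := (hz (k + 1)).1
  have h4 := (hz k).1
  have h5 := (hz k).2
  constructor
  · rw [inv_le_iff_one_le_mul₀ (by linarith), ← h5]
    exact mul_le_mul_of_nonneg_left (by linarith [h3.2]) h4.1.le
  · nlinarith [mul_pos h4.1 h3.1]

end Tails

theorem le_abs_sub_of_tails {N a a' : ℕ → ℕ} {z w : ℕ → ℝ} (hN : ∀ k, 2 ≤ N k)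
    (ha : ∀ k, N k ≤ a k ∧ a k < 2 * N k) (ha' : ∀ k, N k ≤ a' k ∧ a' k < 2 * N k)
    (hz : ∀ k, z k ∈ Set.Ioo (0 : ℝ) 1 ∧ z k * (a k + z (k + 1)) = 1)
    (hw : ∀ k, w k ∈ Set.Ioo (0 : ℝ) 1 ∧ w k * (a' k + w (k + 1)) = 1) {n : ℕ}
    (h : ∀ k < n, a k = a' k) (hn : 1 ≤ |(a n : ℝ) - a' n|) :
    |(a n : ℝ) - a' n| / (8 * 4 ^ n * (∏ k ∈ Finset.range n, (N k : ℝ)) ^ 2 * (N n : ℝ) ^ 2) ≤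
      |z 0 - w 0| := by
  have hN0 : ∀ k, (0 : ℝ) < N k := fun k => by exact_mod_cast zero_lt_two.trans_le (hN k)
  have hzw : ∀ k, (2 * (N k : ℝ))⁻¹ * (2 * (N k : ℝ))⁻¹ ≤ z k * w k := fun k =>
    mul_le_mul (tail_bounds hN ha hz k).1 (tail_bounds hN ha' hw k).1
      (inv_nonneg.2 (by linarith [hN0 k])) (hz k).1.1.le
  have hprod : ∏ k ∈ Finset.range n, (2 * (N k : ℝ))⁻¹ * (2 * (N k : ℝ))⁻¹ ≤
      ∏ k ∈ Finset.range n, z k * w k :=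
    Finset.prod_le_prod (fun k _ => mul_self_nonneg _) fun k _ => hzw k
  have hsub : z n - w n = z n * w n * ((a' n - a n) + (w (n + 1) - z (n + 1))) := by
    linear_combination w n * (hz n).2 - z n * (hw n).2
  have hlast : |(a n : ℝ) - a' n| / 2 ≤ |((a' n : ℝ) - a n) + (w (n + 1) - z (n + 1))| := by
    have h1 : |w (n + 1) - z (n + 1)| ≤ 1 / 2 := by
      rw [abs_sub_le_iff]
      constructor <;> linarith [(tail_bounds hN ha hz (n + 1)).2,
        (tail_bounds hN ha' hw (n + 1)).2, (hz (n + 1)).1.1, (hw (n + 1)).1.1]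
    have h2 := abs_sub_abs_le_abs_add ((a' n : ℝ) - a n) (w (n + 1) - z (n + 1))
    rw [abs_sub_comm (a' n : ℝ)] at h2
    linarith
  rw [abs_sub_eq_prod_mul_abs_sub (fun k _ => (hz k).1.1) (fun k _ => (hw k).1.1)
    (fun k _ => (hz k).2) (fun k hk => by rw [h k hk]; exact (hw k).2), hsub, abs_mul,
    abs_of_pos (mul_pos (hz n).1.1 (hw n).1.1)]
  calc _ = (∏ k ∈ Finset.range n, (2 * (N k : ℝ))⁻¹ * (2 * (N k : ℝ))⁻¹) *
        ((2 * (N n : ℝ))⁻¹ * (2 * (N n : ℝ))⁻¹ * (|(a n : ℝ) - a' n| / 2)) := by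
        rw [Finset.prod_mul_distrib, Finset.prod_inv_distrib, Finset.prod_mul_distrib,
          Finset.prod_const, Finset.card_range, show (4 : ℝ) = 2 * 2 by norm_num, mul_pow]
        have := hN0 n
        have := Finset.prod_pos fun k (_ : k ∈ Finset.range n) => hN0 k
        field_simp
        norm_num
    _ ≤ _ := by
        have := hzw n
        have := hN0 n
        have : 0 ≤ ∏ k ∈ Finset.range n, z k * w k :=
          Finset.prod_nonneg fun k _ => mul_nonneg (hz k).1.1.le (hw k).1.1.le
        have := mul_nonneg (hz n).1.1.le (hw n).1.1.le
        gcongr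

/-! ### The lower bound -/

theorem le_mul_rpow_of_bounds {s C K M Q R D X : ℝ} (hs0 : 0 < s) (hs1 : s ≤ 1) (hK : 0 < K)
    (hQ : 0 < Q) (hKQ : K ≤ Q) (hM : 0 < M) (hR : 0 < R) (hD : M * Q * D ≤ 2 * K)
    (hX : K / (R * M ^ 2 * Q ^ 2) ≤ X) (hC : (R * M ^ 2 * Q) ^ s ≤ C * M) :
    D ≤ 2 * C * X ^ s := by
  have hC0 : 0 < C :=
    pos_of_mul_pos_left ((by positivity : 0 < (R * M ^ 2 * Q) ^ s).trans_le hC) hM.le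
  have h1 : K / Q ≤ (K / Q) ^ s := by
    conv_lhs => rw [← Real.rpow_one (K / Q)]
    exact Real.rpow_le_rpow_of_exponent_ge (by positivity) ((div_le_one hQ).2 hKQ) hs1
  have h2 : (K / Q) ^ s / (C * M) ≤ X ^ s := by
    calc (K / Q) ^ s / (C * M) ≤ (K / Q) ^ s / (R * M ^ 2 * Q) ^ s := by gcongr
      _ = (K / (R * M ^ 2 * Q ^ 2)) ^ s := by
        rw [← Real.div_rpow (by positivity) (by positivity)]
        congr 1
        field_simp
      _ ≤ X ^ s := by gcongr
  calc D ≤ 2 * C * ((K / Q) / (C * M)) := by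
        rw [show 2 * C * ((K / Q) / (C * M)) = 2 * K / (M * Q) by field_simp,
          le_div_iff₀ (by positivity)]
        linarith
    _ ≤ 2 * C * ((K / Q) ^ s / (C * M)) := by gcongr
    _ ≤ 2 * C * X ^ s := by gcongr

theorem le_dimH_of_antiHolder {φ : ℝ → ℝ} {C s : NNReal} (hs : 0 < s)
    (h : ∀ t ∈ Set.Ico (0 : ℝ) 1, ∀ u ∈ Set.Ico (0 : ℝ) 1,
      |t - u| ≤ C * |φ t - φ u| ^ (s : ℝ)) :
    (s : ENNReal) ≤ dimH (φ '' Set.Ico 0 1) := by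
  have hinj : Set.InjOn φ (Set.Ico 0 1) := by
    intro t ht u hu htu
    have h0 := h t ht u hu
    rw [htu, sub_self, abs_zero, Real.zero_rpow (NNReal.coe_pos.2 hs).ne', mul_zero] at h0
    exact sub_eq_zero.1 (abs_nonpos_iff.1 h0)
  have hinv := hinj.leftInvOn_invFunOn
  have hholder : HolderOnWith C s (Function.invFunOn φ (Set.Ico 0 1)) (φ '' Set.Ico 0 1) := by
    rintro _ ⟨t, ht, rfl⟩ _ ⟨u, hu, rfl⟩
    rw [hinv ht, hinv hu, edist_dist, edist_dist,
      ENNReal.ofReal_rpow_of_nonneg dist_nonneg s.coe_nonneg,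
      ← ENNReal.ofReal_coe_nnreal, ← ENNReal.ofReal_mul C.coe_nonneg]
    exact ENNReal.ofReal_le_ofReal (h t ht u hu)
  have hdim := hholder.dimH_image_le hs
  rw [hinv.image_image, Real.dimH_of_nonempty_interior (by simp [interior_Ico]),
    Module.finrank_self, Nat.cast_one, ENNReal.le_div_iff_mul_le (by simp [hs.ne']) (by simp),
    one_mul] at hdim
  exact hdim

theorem le_dimH_forall_le_partQuot {N : ℕ → ℕ} (hN : ∀ k, 2 ≤ N k) {s : NNReal} {C : ℝ}
    (hs0 : 0 < s) (hs1 : s ≤ 1)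
    (hC : ∀ n, (8 * 4 ^ n * (∏ k ∈ Finset.range n, (N k : ℝ)) ^ 2 * N n) ^ (s : ℝ) ≤
      C * ∏ k ∈ Finset.range n, (N k : ℝ)) :
    (s : ENNReal) ≤ dimH {x ∈ Set.Ico (0 : ℝ) 1 | ∀ k, N k ≤ partQuot x (k + 1)} := by
  have hN0 : ∀ k, 0 < N k := fun k => zero_lt_two.trans_le (hN k)
  have hNr : ∀ k, (0 : ℝ) < N k := fun k => by exact_mod_cast hN0 k
  set a : ℝ → ℕ → ℕ := fun t k => N k + radixDigit N t k with ha
  choose z hz using fun t => exists_continuedFraction_tails (a t)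
    fun k => (hN0 k).trans_le (Nat.le_add_right _ _)
  have hab : ∀ t ∈ Set.Ico (0 : ℝ) 1, ∀ k, N k ≤ a t k ∧ a t k < 2 * N k := fun t ht k =>
    ⟨Nat.le_add_right _ _, by
      have := radixDigit_lt hN0 ht k
      simp only [ha]
      omega⟩
  have hC0 : 0 ≤ C := by
    have h := hC 0
    simp only [Finset.range_zero, Finset.prod_empty, mul_one] at h
    exact le_trans (by positivity) h
  refine (le_dimH_of_antiHolder (φ := fun t => z t 0) (C := ⟨2 * C, by positivity⟩) hs0 ?_).trans
    (dimH_mono ?_)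
  · intro t ht u hu
    change |t - u| ≤ 2 * C * |z t 0 - z u 0| ^ (s : ℝ)
    rcases eq_or_ne t u with rfl | htu
    · rw [sub_self, abs_zero]
      positivity
    classical
    have hex := exists_radixDigit_ne hN ht hu htu
    set n := Nat.find hex with hn
    have hlt : ∀ k < n, radixDigit N t k = radixDigit N u k := fun k hk =>
      not_not.1 (Nat.find_min hex hk)
    have hne : radixDigit N t n ≠ radixDigit N u n := Nat.find_spec hex
    have hK : 1 ≤ |(radixDigit N t n : ℝ) - radixDigit N u n| := by
      have : (1 : ℤ) ≤ |(radixDigit N t n : ℤ) - radixDigit N u n| :=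
        Int.one_le_abs (sub_ne_zero.2 (by exact_mod_cast hne))
      exact_mod_cast this
    have hKN : |(radixDigit N t n : ℝ) - radixDigit N u n| ≤ N n := by
      have h1 : (radixDigit N t n : ℝ) ≤ N n := by exact_mod_cast (radixDigit_lt hN0 ht n).le
      have h2 : (radixDigit N u n : ℝ) ≤ N n := by exact_mod_cast (radixDigit_lt hN0 hu n).le
      rw [abs_sub_le_iff]
      constructor <;> linarith [Nat.cast_nonneg (α := ℝ) (radixDigit N t n),
        Nat.cast_nonneg (α := ℝ) (radixDigit N u n)]
    have haK : (a t n : ℝ) - a u n = radixDigit N t n - radixDigit N u n := by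
      simp [ha]
    have hX := le_abs_sub_of_tails hN (hab t ht) (hab u hu) (hz t) (hz u) (n := n)
      (fun k hk => by simp only [ha, hlt k hk]) (by rwa [haK])
    rw [haK] at hX
    exact le_mul_rpow_of_bounds (NNReal.coe_pos.2 hs0) (by exact_mod_cast hs1)
      (zero_lt_one.trans_le hK) (hNr n) hKN (Finset.prod_pos fun k _ => hNr k) (by positivity)
      (prod_mul_abs_sub_le ht hu hlt hK) hX (hC n)
  · rintro _ ⟨t, ht, rfl⟩
    refine ⟨Set.Ioo_subset_Ico_self (hz t 0).1, fun k => ?_⟩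
    rw [partQuot_of_tails (hz t)]
    exact (hab t ht k).1

theorem exists_bound_ceil_rpow {b c s : ℝ} (hb : 1 < b) (hc : 1 < c) (hs0 : 0 < s)
    (hs : s * (b + 1) < 1) :
    ∃ C : ℝ, ∀ n : ℕ,
      (8 * 4 ^ n * (∏ k ∈ Finset.range n, ((⌈c ^ b ^ (k + 1)⌉₊ : ℕ) : ℝ)) ^ 2 *
        ((⌈c ^ b ^ (n + 1)⌉₊ : ℕ) : ℝ)) ^ s ≤
      C * ∏ k ∈ Finset.range n, ((⌈c ^ b ^ (k + 1)⌉₊ : ℕ) : ℝ) := by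
  have hb1 : 0 < b - 1 := sub_pos.2 hb
  have hb0 : 0 < b := by linarith
  have hc0 : 0 < c := by linarith
  have hL : 0 < Real.log c := Real.log_pos hc
  set L := Real.log c
  set γ := L * b * ((1 - 2 * s) / (b - 1) - s) with hγ
  have hγ0 : 0 < γ := by
    refine mul_pos (by positivity) (sub_pos.2 ?_)
    rw [lt_div_iff₀ hb1]
    linarith
  obtain ⟨A, hA⟩ : BddAbove (Set.range fun n : ℕ => s * Real.log 4 * n - γ * b ^ n) := by
    refine Filter.IsBoundedUnder.bddAbove_range (isBoundedUnder_of_eventually_le (a := 0) ?_)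
    have ht := (tendsto_pow_const_div_const_pow_of_one_lt 1 hb).const_mul (s * Real.log 4)
    rw [mul_zero] at ht
    filter_upwards [ht.eventually_lt_const hγ0] with n hn
    rw [pow_one, ← mul_div_assoc, div_lt_iff₀ (by positivity)] at hn
    linarith
  refine ⟨Real.exp (A + s * (Real.log 8 + Real.log 2) + (1 - 2 * s) * (L * b / (b - 1))),
    fun n => ?_⟩
  have hone : ∀ k : ℕ, 1 ≤ c ^ b ^ (k + 1) := fun k => Real.one_le_rpow hc.le (by positivity)
  have hceil : ∀ k : ℕ, c ^ b ^ (k + 1) ≤ ((⌈c ^ b ^ (k + 1)⌉₊ : ℕ) : ℝ) := fun k => Nat.le_ceil _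
  have hQ : (0 : ℝ) < (⌈c ^ b ^ (n + 1)⌉₊ : ℕ) := by linarith [hone n, hceil n]
  have hlogQ : Real.log ((⌈c ^ b ^ (n + 1)⌉₊ : ℕ) : ℝ) ≤ Real.log 2 + b ^ (n + 1) * L := by
    rw [← Real.log_rpow hc0, ← Real.log_mul (by norm_num) (by linarith [hone n])]
    refine Real.log_le_log hQ ?_
    linarith [hone n, Nat.ceil_lt_add_one (zero_le_one.trans (hone n))]
  set M : ℝ := ∏ k ∈ Finset.range n, ((⌈c ^ b ^ (k + 1)⌉₊ : ℕ) : ℝ) with hM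
  have hM0 : 0 < M := Finset.prod_pos fun k _ => by linarith [hone k, hceil k]
  have hlogM : L * b / (b - 1) * (b ^ n - 1) ≤ Real.log M := by
    rw [hM, Real.log_prod fun k _ => by linarith [hone k, hceil k]]
    calc L * b / (b - 1) * (b ^ n - 1) = ∑ k ∈ Finset.range n, b ^ (k + 1) * L := by
          simp_rw [pow_succ, mul_assoc]
          rw [← Finset.sum_mul, geom_sum_eq hb.ne']
          ring
      _ ≤ _ := by
          refine Finset.sum_le_sum fun k _ => ?_
          rw [← Real.log_rpow hc0]
          exact Real.log_le_log (by positivity) (hceil k)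
  rw [← Real.log_le_log_iff (by positivity) (by positivity), Real.log_rpow (by positivity),
    Real.log_mul (by positivity) hQ.ne', Real.log_mul (by positivity) (by positivity),
    Real.log_mul (by norm_num) (by positivity), Real.log_pow, Real.log_pow,
    Real.log_mul (Real.exp_pos _).ne' hM0.ne', Real.log_exp]
  have hAn : s * Real.log 4 * n - γ * b ^ n ≤ A := hA ⟨n, rfl⟩
  have h1 := mul_le_mul_of_nonneg_left hlogQ hs0.le
  have h2 := mul_le_mul_of_nonneg_left hlogM (show 0 ≤ 1 - 2 * s by nlinarith)
  have h3 : γ * b ^ n = (1 - 2 * s) * (L * b / (b - 1) * b ^ n) - s * (b ^ (n + 1) * L) := by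
    rw [hγ, pow_succ]
    ring
  push_cast
  linarith

theorem le_dimH_forall {b c : ℝ} (hb : 1 < b) (hc : 1 < c) :
    ENNReal.ofReal (1 / (b + 1)) ≤ dimH {x ∈ Set.Ico (0 : ℝ) 1 | ∀ n : ℕ, 1 ≤ n →
        c ^ (b ^ n) ≤ (partQuot x n : ℝ)} := by
  refine ENNReal.le_of_forall_nnreal_lt fun s hs => ?_
  rcases eq_zero_or_pos s with rfl | hs0
  · simp
  have hs' : (s : ℝ) < 1 / (b + 1) := by
    rw [← ENNReal.ofReal_coe_nnreal, ENNReal.ofReal_lt_ofReal_iff'] at hs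
    exact hs.1
  rw [lt_div_iff₀ (by linarith)] at hs'
  have hs0' : 0 < (s : ℝ) := NNReal.coe_pos.2 hs0
  obtain ⟨C, hC⟩ := exists_bound_ceil_rpow hb hc hs0' hs'
  have hs1 : (s : ℝ) ≤ 1 := by nlinarith
  refine (le_dimH_forall_le_partQuot (N := fun k => ⌈c ^ b ^ (k + 1)⌉₊) (fun k => ?_) hs0
    (by exact_mod_cast hs1) hC).trans (dimH_mono ?_)
  · refine Nat.lt_ceil.2 ?_
    rw [Nat.cast_one]
    exact Real.one_lt_rpow hc (by positivity)
  · rintro x ⟨hx, h⟩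
    refine ⟨hx, fun n hn => ?_⟩
    obtain ⟨n, rfl⟩ := Nat.exists_eq_add_of_le' hn
    exact Nat.ceil_le.1 (h n)

theorem stmt_14 (b c : ℝ) (hb : 1 < b) (hc : 1 < c) :
    dimH {x ∈ Set.Ico (0 : ℝ) 1 | ∃ᶠ n in Filter.atTop,
        c ^ (b ^ n) ≤ (partQuot x n : ℝ)} = ENNReal.ofReal (1 / (b + 1)) ∧
    dimH {x ∈ Set.Ico (0 : ℝ) 1 | ∀ n : ℕ, 1 ≤ n →
        c ^ (b ^ n) ≤ (partQuot x n : ℝ)} = ENNReal.ofReal (1 / (b + 1)) := by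
  have hupper := dimH_frequently_le hb hc
  have hlower := le_dimH_forall hb hc
  have hmono : dimH {x ∈ Set.Ico (0 : ℝ) 1 | ∀ n : ℕ, 1 ≤ n →
      c ^ (b ^ n) ≤ (partQuot x n : ℝ)} ≤ dimH {x ∈ Set.Ico (0 : ℝ) 1 | ∃ᶠ n in Filter.atTop,
        c ^ (b ^ n) ≤ (partQuot x n : ℝ)} :=
    dimH_mono fun x hx => ⟨hx.1, ((eventually_ge_atTop 1).mono hx.2).frequently⟩
  exact ⟨hupper.antisymm (hlower.trans hmono), (hmono.trans hupper).antisymm hlower⟩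
end
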